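/- Let f(z) = ∫₀¹ φ(t)dt/(1-tz) and g(z) = ∫₀¹ ψ(t)dt/(1-tz) with nonnegative Borel functions φ, ψ on (0,1) satisfying ∫₀¹φ = ∫₀¹ψ = 1. If φ(t)ψ(s) ≥ φ(s)ψ(t) for all 0 < s < t < 1, then f/g ∈ 𝒯, i.e., the Taylor coefficients of f/g at 0 form a Hausdorff moment sequence. -/

import Mathlib

open MeasureTheory Complex Filter Topology

/-- the slit plane `ℂ ∖ [1,∞)` -/
def SlitOne : Set ℂ := {z | 1 - z ∈ slitPlane}

lemma mem_SlitOne (z : ℂ) : z ∈ SlitOne ↔ ¬(z.im = 0 ∧ 1 ≤ z.re) := by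
  simp only [SlitOne, Set.mem_ofPred_eq, mem_slitPlane_iff, sub_re, one_re, sub_im, one_im]
  constructor
  · rintro (h | h) ⟨h1, h2⟩
    · linarith
    · apply h; simp [h1]
  · intro h
    by_cases h1 : z.im = 0
    · left
      by_contra h2
      exact h ⟨h1, by linarith⟩
    · right
      simpa using h1

lemma isOpen_SlitOne : IsOpen SlitOne :=
  isOpen_slitPlane.preimage (continuous_const.sub continuous_id)

lemma kernel_ne {z : ℂ} (hz : z ∈ SlitOne) {t : ℝ} (ht : t ∈ Set.Icc (0:ℝ) 1) :
    (1 - (t:ℂ) * z) ≠ 0 := by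
  rw [mem_SlitOne] at hz
  intro h
  apply hz
  have hre := congrArg Complex.re h
  have him := congrArg Complex.im h
  simp at hre him
  have ht0 : t ≠ 0 := by
    rintro rfl
    simp at hre
  have him : z.im = 0 := by tauto
  refine ⟨him, ?_⟩
  have h0 : 0 < t := lt_of_le_of_ne ht.1 (Ne.symm ht0)
  by_contra hlt
  push Not at hlt
  nlinarith [ht.2]

lemma kernel_bound {K : Set ℂ} (hK : IsCompact K) (hKS : K ⊆ SlitOne) :
    ∃ C : ℝ, ∀ z ∈ K, ∀ t ∈ Set.Icc (0:ℝ) 1, ‖(1 - (t:ℂ) * z)⁻¹‖ ≤ C := by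
  have hc : IsCompact ((Set.Icc (0:ℝ) 1) ×ˢ K) := isCompact_Icc.prod hK
  obtain ⟨C, hC⟩ := hc.exists_bound_of_continuousOn
    (f := fun p : ℝ × ℂ => (1 - (p.1:ℂ) * p.2)⁻¹) (by
      apply ContinuousOn.inv₀
      · fun_prop
      · rintro ⟨t, z⟩ ⟨ht, hz⟩
        exact kernel_ne (hKS hz) ht)
  exact ⟨C, fun z hz t ht => hC (t, z) ⟨ht, hz⟩⟩

lemma kernel_bound1 {z : ℂ} (hz : z ∈ SlitOne) :
    ∃ C : ℝ, ∀ t ∈ Set.Icc (0:ℝ) 1, ‖(1 - (t:ℂ) * z)⁻¹‖ ≤ C := by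
  obtain ⟨C, hC⟩ := kernel_bound (K := {z}) isCompact_singleton (by simpa using hz)
  exact ⟨C, hC z rfl⟩

lemma stieltjes_integrable {φ : ℝ → ℝ} (hφ : IntegrableOn φ (Set.Ioo (0:ℝ) 1))
    {z : ℂ} (hz : z ∈ SlitOne) :
    IntegrableOn (fun t : ℝ => (φ t : ℂ) * (1 - (t:ℂ) * z)⁻¹) (Set.Ioo (0:ℝ) 1) := by
  obtain ⟨C, hC⟩ := kernel_bound1 hz
  refine Integrable.mul_bdd (c := C) hφ.ofReal (Measurable.aestronglyMeasurable (by fun_prop)) ?_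
  filter_upwards [ae_restrict_mem measurableSet_Ioo] with t ht
  exact hC t ⟨ht.1.le, ht.2.le⟩

lemma stieltjes_diff {φ : ℝ → ℝ} (hφ : IntegrableOn φ (Set.Ioo (0:ℝ) 1))
    {z : ℂ} (hz : z ∈ SlitOne) :
    DifferentiableAt ℂ (fun z : ℂ => ∫ t in Set.Ioo (0:ℝ) 1, (φ t : ℂ) * (1 - (t:ℂ) * z)⁻¹) z := by
  obtain ⟨ε, hε, hsub⟩ := Metric.nhds_basis_closedBall.mem_iff.1 (isOpen_SlitOne.mem_nhds hz)
  obtain ⟨C, hC⟩ := kernel_bound (isCompact_closedBall z ε) hsub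
  have hC0 : 0 ≤ C := (norm_nonneg _).trans (hC z (Metric.mem_closedBall_self hε.le) 0 (by simp))
  refine (hasDerivAt_integral_of_dominated_loc_of_deriv_le
    (μ := volume.restrict (Set.Ioo (0:ℝ) 1))
    (F := fun z t => (φ t : ℂ) * (1 - (t:ℂ) * z)⁻¹)
    (F' := fun z t => (φ t : ℂ) * ((t:ℂ) * ((1 - (t:ℂ) * z)⁻¹)^2))
    (bound := fun t => ‖φ t‖ * C^2)
    (Metric.closedBall_mem_nhds z hε) ?_ (stieltjes_integrable hφ hz) ?_ ?_ ?_ ?_).2.differentiableAt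
  · filter_upwards with w
    exact hφ.ofReal.aestronglyMeasurable.mul (Measurable.aestronglyMeasurable (by fun_prop))
  · exact hφ.ofReal.aestronglyMeasurable.mul (Measurable.aestronglyMeasurable (by fun_prop))
  · filter_upwards [ae_restrict_mem measurableSet_Ioo] with t ht
    intro w hw
    have h1 := hC w hw t ⟨ht.1.le, ht.2.le⟩
    rw [norm_mul, norm_mul, norm_pow, Complex.norm_real, Complex.norm_real]
    have h2 : ‖t‖ ≤ 1 := by rw [Real.norm_eq_abs, abs_of_pos ht.1]; exact ht.2.le
    have h3 : ‖(1 - (t:ℂ) * w)⁻¹‖^2 ≤ C^2 := by gcongr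
    have h4 : ‖t‖ * ‖(1 - (t:ℂ) * w)⁻¹‖^2 ≤ 1 * C^2 := by gcongr
    rw [one_mul] at h4
    gcongr
  · exact hφ.norm.mul_const _
  · filter_upwards [ae_restrict_mem measurableSet_Ioo] with t ht
    intro w hw
    have hne := kernel_ne (hsub hw) (t := t) ⟨ht.1.le, ht.2.le⟩
    have h1 : HasDerivAt (fun w : ℂ => 1 - (t:ℂ) * w) (-(t:ℂ)) w := by
      simpa using ((hasDerivAt_id w).const_mul (t:ℂ)).const_sub 1
    have h2 := (h1.inv hne).const_mul (φ t : ℂ)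
    have e : (φ t : ℂ) * ((t:ℂ) * ((1 - (t:ℂ) * w)⁻¹)^2) =
        (φ t : ℂ) * (- -(t:ℂ) / (1 - (t:ℂ) * w)^2) := by
      rw [neg_neg, div_eq_mul_inv, inv_pow]
    rw [e]
    exact h2

lemma stieltjes_conj (φ : ℝ → ℝ) (z : ℂ) :
    ∫ t in Set.Ioo (0:ℝ) 1, (φ t : ℂ) * (1 - (t:ℂ) * (starRingEnd ℂ z))⁻¹ =
      starRingEnd ℂ (∫ t in Set.Ioo (0:ℝ) 1, (φ t : ℂ) * (1 - (t:ℂ) * z)⁻¹) := by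
  rw [← integral_conj]
  simp

/-- Chebyshev-type inequality. -/
lemma cheb {a b : ℝ → ℝ} (ha : IntegrableOn a (Set.Ioo (0:ℝ) 1))
    (hb : IntegrableOn b (Set.Ioo (0:ℝ) 1))
    (hat : IntegrableOn (fun t => t * a t) (Set.Ioo (0:ℝ) 1))
    (hbt : IntegrableOn (fun t => t * b t) (Set.Ioo (0:ℝ) 1))
    (hcond : ∀ s t : ℝ, 0 < s → s < t → t < 1 → a s * b t ≤ a t * b s) :
    (∫ t in Set.Ioo (0:ℝ) 1, a t) * (∫ t in Set.Ioo (0:ℝ) 1, t * b t) ≤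
    (∫ t in Set.Ioo (0:ℝ) 1, t * a t) * (∫ t in Set.Ioo (0:ℝ) 1, b t) := by
  set ν : Measure ℝ := volume.restrict (Set.Ioo (0:ℝ) 1) with hν
  have e1 := integral_prod_mul (μ := ν) (ν := ν) (fun t => t * a t) b
  have e2 := integral_prod_mul (μ := ν) (ν := ν) a (fun t => t * b t)
  have i1 : Integrable (fun p : ℝ × ℝ => p.1 * a p.1 * b p.2) (ν.prod ν) := hat.mul_prod hb
  have i2 : Integrable (fun p : ℝ × ℝ => a p.1 * (p.2 * b p.2)) (ν.prod ν) := ha.mul_prod hbt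
  set D : ℝ × ℝ → ℝ := fun p => p.1 * a p.1 * b p.2 - a p.1 * (p.2 * b p.2) with hD
  have iD : Integrable D (ν.prod ν) := i1.sub i2
  have eD : ∫ p, D p ∂(ν.prod ν) = (∫ t, t * a t ∂ν) * (∫ t, b t ∂ν) -
      (∫ t, a t ∂ν) * (∫ t, t * b t ∂ν) := by
    rw [← e1, ← e2]
    exact integral_sub i1 i2
  have eS : ∫ p, D p.swap ∂(ν.prod ν) = ∫ p, D p ∂(ν.prod ν) := integral_prod_swap D
  have hsum : 0 ≤ ∫ p, (D p + D p.swap) ∂(ν.prod ν) := by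
    apply integral_nonneg_of_ae
    have : ∀ᵐ p ∂(ν.prod ν), p ∈ (Set.Ioo (0:ℝ) 1) ×ˢ (Set.Ioo (0:ℝ) 1) := by
      rw [hν, Measure.prod_restrict]
      exact ae_restrict_mem (measurableSet_Ioo.prod measurableSet_Ioo)
    filter_upwards [this] with p hp
    obtain ⟨⟨h1, h2⟩, ⟨h3, h4⟩⟩ := hp
    simp only [hD, Prod.fst_swap, Prod.snd_swap, Pi.zero_apply]
    rcases lt_trichotomy p.1 p.2 with h | h | h
    · nlinarith [hcond p.1 p.2 h1 h h4]
    · rw [h]; apply le_of_eq; ring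
    · nlinarith [hcond p.2 p.1 h3 h h2]
  rw [integral_add iD (show Integrable (fun p => D p.swap) (ν.prod ν) from iD.swap), eS, eD] at hsum
  linarith

lemma stieltjes_zero {φ : ℝ → ℝ} (h1 : ∫ t in Set.Ioo (0:ℝ) 1, φ t = 1) :
    ∫ t in Set.Ioo (0:ℝ) 1, (φ t : ℂ) * (1 - (t:ℂ) * 0)⁻¹ = 1 := by
  simp only [mul_zero, sub_zero, inv_one, mul_one]
  rw [integral_complex_ofReal, h1]; simp

lemma kernel_re (z : ℂ) (t : ℝ) : ((1 - (t:ℂ) * z)⁻¹).re =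
    (normSq (1 - (t:ℂ) * z))⁻¹ - z.re * (t * (normSq (1 - (t:ℂ) * z))⁻¹) := by
  rw [inv_re]; simp; ring

lemma kernel_im (z : ℂ) (t : ℝ) : ((1 - (t:ℂ) * z)⁻¹).im =
    z.im * (t * (normSq (1 - (t:ℂ) * z))⁻¹) := by
  rw [inv_im]; simp; ring

lemma weight_integrable {φ : ℝ → ℝ} (hφ : IntegrableOn φ (Set.Ioo (0:ℝ) 1))
    {z : ℂ} (hz : z ∈ SlitOne) :
    IntegrableOn (fun t : ℝ => φ t * (normSq (1 - (t:ℂ) * z))⁻¹) (Set.Ioo (0:ℝ) 1) := by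
  obtain ⟨C, hC⟩ := kernel_bound1 hz
  refine Integrable.mul_bdd (c := C^2) hφ ?_ ?_
  · have : Measurable fun t : ℝ => (normSq (1 - (t:ℂ) * z))⁻¹ := by
      have : Continuous fun t : ℝ => (normSq (1 - (t:ℂ) * z)) := by fun_prop
      exact this.measurable.inv
    exact this.aestronglyMeasurable
  filter_upwards [ae_restrict_mem measurableSet_Ioo] with t ht
  have := hC t ⟨ht.1.le, ht.2.le⟩
  rw [← map_inv₀, Real.norm_eq_abs, abs_of_nonneg (normSq_nonneg _), Complex.normSq_eq_norm_sq]
  gcongr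

lemma weight_integrable' {φ : ℝ → ℝ} (hφ : IntegrableOn φ (Set.Ioo (0:ℝ) 1))
    {z : ℂ} (hz : z ∈ SlitOne) :
    IntegrableOn (fun t : ℝ => t * (φ t * (normSq (1 - (t:ℂ) * z))⁻¹)) (Set.Ioo (0:ℝ) 1) := by
  refine Integrable.bdd_mul (c := 1) (weight_integrable hφ hz) (by fun_prop) ?_
  filter_upwards [ae_restrict_mem measurableSet_Ioo] with t ht
  rw [Real.norm_eq_abs, abs_of_pos ht.1]; exact ht.2.le

lemma stieltjes_re {φ : ℝ → ℝ} (hφ : IntegrableOn φ (Set.Ioo (0:ℝ) 1))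
    {z : ℂ} (hz : z ∈ SlitOne) :
    (∫ t in Set.Ioo (0:ℝ) 1, (φ t : ℂ) * (1 - (t:ℂ) * z)⁻¹).re =
    (∫ t in Set.Ioo (0:ℝ) 1, φ t * (normSq (1 - (t:ℂ) * z))⁻¹) -
      z.re * ∫ t in Set.Ioo (0:ℝ) 1, t * (φ t * (normSq (1 - (t:ℂ) * z))⁻¹) := by
  have := integral_re (stieltjes_integrable hφ hz)
  simp only [RCLike.re_eq_complex_re] at this
  rw [← this, ← integral_const_mul,
    ← integral_sub (weight_integrable hφ hz) ((weight_integrable' hφ hz).const_mul _)]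
  congr 1 with t
  rw [re_ofReal_mul, kernel_re]; ring

lemma stieltjes_im {φ : ℝ → ℝ} (hφ : IntegrableOn φ (Set.Ioo (0:ℝ) 1))
    {z : ℂ} (hz : z ∈ SlitOne) :
    (∫ t in Set.Ioo (0:ℝ) 1, (φ t : ℂ) * (1 - (t:ℂ) * z)⁻¹).im =
      z.im * ∫ t in Set.Ioo (0:ℝ) 1, t * (φ t * (normSq (1 - (t:ℂ) * z))⁻¹) := by
  have := integral_im (stieltjes_integrable hφ hz)
  simp only [RCLike.im_eq_complex_im] at this
  rw [← this, ← integral_const_mul]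
  congr 1 with t
  rw [im_ofReal_mul, kernel_im]; ring

lemma quot_im_nonneg {φ ψ : ℝ → ℝ} (hφ : IntegrableOn φ (Set.Ioo (0:ℝ) 1))
    (hψ : IntegrableOn ψ (Set.Ioo (0:ℝ) 1))
    (hcond : ∀ s t : ℝ, 0 < s → s < t → t < 1 → φ s * ψ t ≤ φ t * ψ s)
    {z : ℂ} (hz : z ∈ SlitOne) (him : 0 ≤ z.im) :
    0 ≤ ((∫ t in Set.Ioo (0:ℝ) 1, (φ t : ℂ) * (1 - (t:ℂ) * z)⁻¹) /
      (∫ t in Set.Ioo (0:ℝ) 1, (ψ t : ℂ) * (1 - (t:ℂ) * z)⁻¹)).im := by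
  rw [div_im, stieltjes_re hφ hz, stieltjes_re hψ hz, stieltjes_im hφ hz, stieltjes_im hψ hz,
    ← sub_div]
  apply div_nonneg _ (normSq_nonneg _)
  have := cheb (weight_integrable hφ hz) (weight_integrable hψ hz)
    (weight_integrable' hφ hz) (weight_integrable' hψ hz) (by
      intro s t hs hst ht
      have h1 := hcond s t hs hst ht
      have h2 : 0 ≤ (normSq (1 - (s:ℂ) * z))⁻¹ := inv_nonneg.2 (normSq_nonneg _)
      have h3 : 0 ≤ (normSq (1 - (t:ℂ) * z))⁻¹ := inv_nonneg.2 (normSq_nonneg _)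
      have := mul_le_mul_of_nonneg_right h1 (mul_nonneg h2 h3)
      linarith)
  nlinarith [mul_nonneg him (sub_nonneg.2 this)]

lemma weight_pos {ψ : ℝ → ℝ}
    (hψ0 : ∀ t ∈ Set.Ioo (0:ℝ) 1, 0 ≤ ψ t) (h1 : ∫ t in Set.Ioo (0:ℝ) 1, ψ t = 1)
    {w : ℝ → ℝ} (hw : ∀ t ∈ Set.Ioo (0:ℝ) 1, 0 < w t)
    (hi : IntegrableOn (fun t => ψ t * w t) (Set.Ioo (0:ℝ) 1)) :
    0 < ∫ t in Set.Ioo (0:ℝ) 1, ψ t * w t := by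
  have hnn : 0 ≤ᵐ[volume.restrict (Set.Ioo (0:ℝ) 1)] fun t => ψ t * w t := by
    filter_upwards [ae_restrict_mem measurableSet_Ioo] with t ht
    exact mul_nonneg (hψ0 t ht) (hw t ht).le
  refine lt_of_le_of_ne (integral_nonneg_of_ae hnn) ?_
  intro h
  have := (integral_eq_zero_iff_of_nonneg_ae hnn hi).1 h.symm
  have h0 : ψ =ᵐ[volume.restrict (Set.Ioo (0:ℝ) 1)] 0 := by
    filter_upwards [this, ae_restrict_mem measurableSet_Ioo] with t ht ht'
    simp only [Pi.zero_apply, mul_eq_zero] at ht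
    exact ht.resolve_right (hw t ht').ne'
  rw [integral_congr_ae h0] at h1
  simp at h1

lemma stieltjes_real_re_pos {ψ : ℝ → ℝ} (hψ : IntegrableOn ψ (Set.Ioo (0:ℝ) 1))
    (hψ0 : ∀ t ∈ Set.Ioo (0:ℝ) 1, 0 ≤ ψ t) (h1 : ∫ t in Set.Ioo (0:ℝ) 1, ψ t = 1)
    {z : ℂ} (hz : z ∈ SlitOne) (hr : z.re < 1) :
    0 < (∫ t in Set.Ioo (0:ℝ) 1, (ψ t : ℂ) * (1 - (t:ℂ) * z)⁻¹).re := by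
  have := integral_re (stieltjes_integrable hψ hz)
  simp only [RCLike.re_eq_complex_re] at this
  rw [← this]
  have hi := (stieltjes_integrable hψ hz).re
  simp only [RCLike.re_eq_complex_re, re_ofReal_mul] at hi ⊢
  refine weight_pos hψ0 h1 ?_ hi
  intro t ht
  rw [inv_re]
  apply div_pos
  · simp
    nlinarith [ht.1, ht.2]
  · exact normSq_pos.2 (kernel_ne hz ⟨ht.1.le, ht.2.le⟩)

lemma stieltjes_ne {ψ : ℝ → ℝ} (hψ : IntegrableOn ψ (Set.Ioo (0:ℝ) 1))
    (hψ0 : ∀ t ∈ Set.Ioo (0:ℝ) 1, 0 ≤ ψ t) (h1 : ∫ t in Set.Ioo (0:ℝ) 1, ψ t = 1)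
    {z : ℂ} (hz : z ∈ SlitOne) :
    (∫ t in Set.Ioo (0:ℝ) 1, (ψ t : ℂ) * (1 - (t:ℂ) * z)⁻¹) ≠ 0 := by
  intro h
  by_cases hr : z.re < 1
  · have := stieltjes_real_re_pos hψ hψ0 h1 hz hr
    rw [h] at this
    simp at this
  · have him : z.im ≠ 0 := fun hi => (mem_SlitOne z).1 hz ⟨hi, not_lt.1 hr⟩
    have h2 := stieltjes_im hψ hz
    rw [h] at h2
    have h3 := weight_pos hψ0 h1 (w := fun t => t * (normSq (1 - (t:ℂ) * z))⁻¹) (by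
      intro t ht
      exact mul_pos ht.1 (inv_pos.2 (normSq_pos.2 (kernel_ne hz ⟨ht.1.le, ht.2.le⟩)))) (by
      convert weight_integrable' hψ hz using 2
      ring)
    have h4 : (∫ t in Set.Ioo (0:ℝ) 1, t * (ψ t * (normSq (1 - (t:ℂ) * z))⁻¹)) =
      ∫ t in Set.Ioo (0:ℝ) 1, ψ t * (t * (normSq (1 - (t:ℂ) * z))⁻¹) := by
      congr 1 with t
      ring
    rw [h4] at h2
    simp only [zero_im] at h2
    exact mul_ne_zero him h3.ne' h2.symm

lemma sphere_conj_inv {ζ : ℂ} (hζ : ζ ∈ Metric.sphere (0:ℂ) |1|) :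
    ζ⁻¹ = starRingEnd ℂ ζ := by
  rw [abs_one, mem_sphere_zero_iff_norm] at hζ
  exact inv_eq_conj hζ

lemma disc_ne1 {ζ w : ℂ} (hζ : ‖ζ‖ ≤ 1) (hw : ‖w‖ < 1) : 1 - w * ζ ≠ 0 := by
  intro h
  have h1 : w * ζ = 1 := (sub_eq_zero.1 h).symm
  have h2 : ‖w‖ * ‖ζ‖ = 1 := by rw [← norm_mul, h1, norm_one]
  nlinarith [norm_nonneg w, norm_nonneg ζ]

lemma disc_ne2 {ζ w : ℂ} (hζ : ‖ζ‖ = 1) (hw : ‖w‖ < 1) : ζ - w ≠ 0 := by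
  intro h
  rw [sub_eq_zero.1 h] at hζ
  linarith

lemma circle_rep {G : ℂ → ℂ} (hG : ContinuousOn G (Metric.closedBall 0 1))
    (hd : DifferentiableOn ℂ G (Metric.ball 0 1))
    (hc : ∀ ζ ∈ Metric.sphere (0:ℂ) 1, G (starRingEnd ℂ ζ) = starRingEnd ℂ (G ζ))
    {w : ℂ} (hw : ‖w‖ < 1) :
    G w - G 0 = Real.circleAverage
      (fun ζ => ((2 * ζ.im * (G ζ).im : ℝ) : ℂ) * (w / (1 - 2 * w * (ζ.re : ℂ) + w^2))) 0 1 := by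
  have hcl : DiffContOnCl ℂ G (Metric.ball 0 |1|) := by
    rw [abs_one]
    refine ⟨hd, ?_⟩
    rwa [closure_ball _ one_ne_zero]
  have hw' : w ∈ Metric.ball (0:ℂ) |1| := by simpa using hw
  have a1 : Real.circleAverage (fun ζ => (ζ / (ζ - w)) * G ζ) 0 1 = G w := by
    simpa using hcl.circleAverage_smul_div hw'
  have a2 : Real.circleAverage (fun ζ => (1 - w * ζ)⁻¹ * G ζ) 0 1 = G 0 := by
    have : DiffContOnCl ℂ (fun ζ => (1 - w * ζ)⁻¹ * G ζ) (Metric.ball 0 |1|) := by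
      refine DiffContOnCl.smul (𝕜 := ℂ) (𝕜' := ℂ) ?_ hcl
      rw [abs_one]
      refine ⟨?_, ?_⟩
      · intro ζ hζ
        have hne := disc_ne1 (by simpa using (mem_ball_zero_iff.1 hζ).le) hw
        apply DifferentiableAt.differentiableWithinAt
        fun_prop (disch := assumption)
      · rw [closure_ball _ one_ne_zero]
        apply ContinuousOn.inv₀
        · fun_prop
        · intro ζ hζ
          exact disc_ne1 (by simpa using hζ) hw
    simpa using this.circleAverage
  have b1 : Real.circleAverage (fun ζ => (1 - w * ζ)⁻¹ * starRingEnd ℂ (G ζ)) 0 1 = G w := by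
    rw [← a1, ← Real.circleAverage_zero_one_congr_inv (f := fun ζ => (ζ / (ζ - w)) * G ζ)]
    apply Real.circleAverage_congr_sphere
    intro ζ hζ
    have h0 : ‖ζ‖ = 1 := by simpa using hζ
    have hz : ζ ≠ 0 := by rintro rfl; simp at h0
    have h1 := disc_ne1 h0.le hw
    simp only
    rw [← hc ζ (by simpa using hζ), ← sphere_conj_inv hζ]
    congr 1
    field_simp
  have b2 : Real.circleAverage (fun ζ => (ζ / (ζ - w)) * starRingEnd ℂ (G ζ)) 0 1 = G 0 := by
    rw [← a2, ← Real.circleAverage_zero_one_congr_inv (f := fun ζ => (1 - w * ζ)⁻¹ * G ζ)]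
    apply Real.circleAverage_congr_sphere
    intro ζ hζ
    have h0 : ‖ζ‖ = 1 := by simpa using hζ
    have hz : ζ ≠ 0 := by rintro rfl; simp at h0
    have h1 := disc_ne2 h0 hw
    simp only
    rw [← hc ζ (by simpa using hζ), ← sphere_conj_inv hζ]
    congr 1
    field_simp
  have hGs : ContinuousOn G (Metric.sphere 0 |1|) := by
    rw [abs_one]; exact hG.mono Metric.sphere_subset_closedBall
  have hGc : ContinuousOn (fun ζ => starRingEnd ℂ (G ζ)) (Metric.sphere 0 |1|) :=
    continuous_conj.comp_continuousOn hGs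
  have k1 : ContinuousOn (fun ζ : ℂ => ζ / (ζ - w)) (Metric.sphere 0 |1|) := by
    apply ContinuousOn.div₀ (by fun_prop) (by fun_prop)
    intro ζ hζ
    exact disc_ne2 (by simpa using hζ) hw
  have k2 : ContinuousOn (fun ζ : ℂ => (1 - w * ζ)⁻¹) (Metric.sphere 0 |1|) := by
    apply ContinuousOn.inv₀ (by fun_prop)
    intro ζ hζ
    have h0 : ‖ζ‖ = 1 := by simpa using hζ
    exact disc_ne1 h0.le hw
  have i1 := (k1.mul hGs).circleIntegrable'
  have i2 := (k2.mul hGs).circleIntegrable'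
  have j1 := (k2.mul hGc).circleIntegrable'
  have j2 := (k1.mul hGc).circleIntegrable'
  have e1 := Real.circleAverage_sub i1 i2
  have e2 := Real.circleAverage_sub j1 j2
  have e3 := Real.circleAverage_add (i1.sub i2) (j1.sub j2)
  have e4 : Real.circleAverage (((fun ζ : ℂ => ζ / (ζ - w)) * G - (fun ζ : ℂ => (1 - w * ζ)⁻¹) * G)
      + ((fun ζ : ℂ => (1 - w * ζ)⁻¹) * (fun ζ => starRingEnd ℂ (G ζ)) -
        (fun ζ : ℂ => ζ / (ζ - w)) * (fun ζ => starRingEnd ℂ (G ζ)))) 0 1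
      = (G w - G 0) + (G w - G 0) := by
    refine e3.trans ?_
    refine congrArg₂ (· + ·) (e1.trans ?_) (e2.trans ?_)
    · exact congrArg₂ (· - ·) a1 a2
    · exact congrArg₂ (· - ·) b1 b2
  have e5 : G w - G 0 = (2:ℝ)⁻¹ • ((G w - G 0) + (G w - G 0)) := by
    rw [Complex.real_smul]; push_cast; ring
  rw [e5, ← e4, ← Real.circleAverage_smul]
  apply Real.circleAverage_congr_sphere
  intro ζ hζ
  have h0 : ‖ζ‖ = 1 := by simpa using hζ
  have h1 := disc_ne1 h0.le hw
  have h2 := disc_ne2 h0 hw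
  have hz : ζ ≠ 0 := by rintro rfl; simp at h0
  have hG1 : (G ζ) - starRingEnd ℂ (G ζ) = 2 * (G ζ).im * I := by
    rw [Complex.sub_conj]; push_cast; ring
  have hz1 : ζ - ζ⁻¹ = 2 * ζ.im * I := by
    rw [sphere_conj_inv hζ, Complex.sub_conj]; push_cast; ring
  have hz2 : ζ + ζ⁻¹ = 2 * ζ.re := by
    rw [sphere_conj_inv hζ, Complex.add_conj]; push_cast; ring
  have hden : (1 - 2 * w * (ζ.re : ℂ) + w^2) = (1 - w * ζ) * ((ζ - w) / ζ) := by
    have : 2 * w * (ζ.re : ℂ) = w * (2 * ζ.re) := by ring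
    rw [this, ← hz2]
    field_simp
    ring
  have him : ((2 * ζ.im * (G ζ).im : ℝ) : ℂ) =
      - (2:ℂ)⁻¹ * (ζ - ζ⁻¹) * (G ζ - starRingEnd ℂ (G ζ)) := by
    rw [hz1, hG1]; push_cast
    ring_nf
    rw [I_sq]; ring
  simp only [Pi.smul_apply, Pi.add_apply, Pi.sub_apply, Pi.mul_apply, Complex.real_smul]
  rw [him, hden]
  push_cast
  generalize starRingEnd ℂ (G ζ) = c
  have h1' : 1 - ζ * w ≠ 0 := by rwa [mul_comm]
  field_simp
  ring

/-- The Koebe-type map. -/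
noncomputable def koe (w : ℂ) : ℂ := 4 * w / (1 + w)^2

lemma disc_ne3 {w : ℂ} (hw : ‖w‖ < 1) : 1 + w ≠ 0 := by
  have := disc_ne1 (ζ := -1) (by simp) hw
  simpa using this

lemma koe_kernel {w : ℂ} (hw : ‖w‖ < 1) (c : ℝ) :
    w / (1 - 2 * w * (c : ℂ) + w^2) = koe w / 4 * (1 - (((1 + c) / 2 : ℝ) : ℂ) * koe w)⁻¹ := by
  have h := disc_ne3 hw
  have : (1 - (((1 + c) / 2 : ℝ) : ℂ) * koe w) = (1 - 2 * w * (c : ℂ) + w^2) / (1 + w)^2 := by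
    rw [koe]; push_cast; field_simp; ring
  rw [this, inv_div, koe]
  have h2 : (1 + w)^2 ≠ 0 := pow_ne_zero _ h
  field_simp

lemma disc_measure {G : ℂ → ℂ} (hG : ContinuousOn G (Metric.closedBall 0 1))
    (hd : DifferentiableOn ℂ G (Metric.ball 0 1))
    (hc : ∀ ζ ∈ Metric.sphere (0:ℂ) 1, G (starRingEnd ℂ ζ) = starRingEnd ℂ (G ζ))
    (him : ∀ ζ ∈ Metric.sphere (0:ℂ) 1, 0 ≤ ζ.im * (G ζ).im) :
    ∃ σ : Measure ℝ, IsFiniteMeasure σ ∧ σ (Set.Icc (0:ℝ) 1)ᶜ = 0 ∧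
      ∀ w : ℂ, ‖w‖ < 1 → G w - G 0 = koe w * ∫ t, (1 - (t:ℂ) * koe w)⁻¹ ∂σ := by
  set d : ℝ → ℝ := fun θ => (4 * Real.pi)⁻¹ * ((circleMap 0 1 θ).im * (G (circleMap 0 1 θ)).im)
    with hdd
  have hsph : ∀ θ, circleMap 0 1 θ ∈ Metric.sphere (0:ℂ) 1 := fun θ =>
    circleMap_mem_sphere 0 zero_le_one θ
  have hGcont : Continuous fun θ : ℝ => G (circleMap 0 1 θ) := by
    rw [← continuousOn_univ]
    exact hG.comp (continuous_circleMap 0 1).continuousOn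
      (fun θ _ => Metric.sphere_subset_closedBall (hsph θ))
  have hdcont : Continuous d := by
    refine continuous_const.mul (Continuous.mul ?_ ?_)
    · exact continuous_im.comp (continuous_circleMap 0 1)
    · exact continuous_im.comp hGcont
  have hd0 : ∀ θ, 0 ≤ d θ := fun θ => mul_nonneg (by positivity) (him _ (hsph θ))
  set τ : ℝ → ℝ := fun θ => (1 + Real.cos θ) / 2 with hτ
  have hτm : Measurable τ := by fun_prop
  set σ₀ : Measure ℝ := (volume.restrict (Set.Ioc 0 (2 * Real.pi))).withDensity
    (fun θ => ENNReal.ofReal (d θ)) with hσ₀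
  have hfin : IsFiniteMeasure σ₀ := by
    apply isFiniteMeasure_withDensity_ofReal
    exact (hdcont.integrableOn_Ioc).2
  refine ⟨σ₀.map τ, inferInstance, ?_, ?_⟩
  · rw [Measure.map_apply hτm measurableSet_Icc.compl]
    have : τ ⁻¹' (Set.Icc (0:ℝ) 1)ᶜ = ∅ := by
      ext θ
      simp only [Set.mem_preimage, Set.mem_compl_iff, Set.mem_Icc, Set.mem_empty_iff_false,
        iff_false, not_not, hτ]
      constructor
      · linarith [Real.neg_one_le_cos θ]
      · linarith [Real.cos_le_one θ]
    rw [this]; simp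
  · intro w hw
    rw [integral_map hτm.aemeasurable (Measurable.aestronglyMeasurable (by fun_prop)),
      hσ₀, integral_withDensity_eq_integral_toReal_smul (by fun_prop) (by simp),
      circle_rep hG hd hc hw, Real.circleAverage_def,
      intervalIntegral.integral_of_le (by positivity), ← integral_const_mul, ← integral_smul]
    congr 1 with θ
    rw [ENNReal.toReal_ofReal (hd0 θ), koe_kernel hw]
    have : (circleMap 0 1 θ).re = Real.cos θ := by
      simp [circleMap, Complex.exp_ofReal_mul_I_re]
    rw [this]
    simp only [hdd, hτ, Complex.real_smul]
    push_cast
    field_simp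

lemma kernel_int {σ : Measure ℝ} [IsFiniteMeasure σ] (hσ : σ (Set.Icc (0:ℝ) 1)ᶜ = 0)
    {z : ℂ} (hz : z ∈ SlitOne) : Integrable (fun t : ℝ => (1 - (t:ℂ) * z)⁻¹) σ := by
  obtain ⟨C, hC⟩ := kernel_bound1 hz
  refine Integrable.of_bound (Measurable.aestronglyMeasurable (by fun_prop)) C ?_
  have : ∀ᵐ t ∂σ, t ∈ Set.Icc (0:ℝ) 1 := hσ
  filter_upwards [this] with t ht
  exact hC t ht

lemma lint_le {σ : Measure ℝ} [IsFiniteMeasure σ] (hσ : σ (Set.Icc (0:ℝ) 1)ᶜ = 0)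
    (hpos : ∀ x : ℝ, x < 0 → 0 ≤ (1 + (x:ℂ) * ∫ t, (1 - (t:ℂ) * (x:ℂ))⁻¹ ∂σ).re) :
    ∫⁻ t, (ENNReal.ofReal t)⁻¹ ∂σ ≤ 1 := by
  have hae : ∀ᵐ t ∂σ, t ∈ Set.Icc (0:ℝ) 1 := hσ
  have key : ∀ n : ℕ, ∫⁻ t, ENNReal.ofReal ((t + 1 / ((n:ℝ) + 1))⁻¹) ∂σ ≤ 1 := by
    intro n
    have hn : (0:ℝ) < n + 1 := by positivity
    have h1 := hpos (-((n:ℝ) + 1)) (by linarith)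
    have hz : ((-((n:ℝ) + 1) : ℝ) : ℂ) ∈ SlitOne := by
      rw [mem_SlitOne]
      rintro ⟨-, h⟩
      rw [ofReal_re] at h
      linarith
    have hi := kernel_int hσ hz
    have e1 : ∀ t : ℝ, (1 - (t:ℂ) * ((-((n:ℝ) + 1) : ℝ) : ℂ))⁻¹ =
        (((1 + t * (n + 1))⁻¹ : ℝ) : ℂ) := by
      intro t; push_cast; ring_nf
    simp only [e1] at h1 hi
    rw [integral_complex_ofReal, ← ofReal_mul, add_re, one_re, ofReal_re,
      ← integral_const_mul] at h1
    have hi' : Integrable (fun t : ℝ => (1 + t * ((n:ℝ) + 1))⁻¹) σ := by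
      exact hi.re
    have e2 : ∀ᵐ t ∂σ, (t + 1 / ((n:ℝ) + 1))⁻¹ = ((n:ℝ) + 1) * (1 + t * (n + 1))⁻¹ := by
      filter_upwards [hae] with t ht
      have : 0 < 1 + t * ((n:ℝ) + 1) := by nlinarith [ht.1]
      have h3 : t + 1 / ((n:ℝ) + 1) = (1 + t * (n + 1)) / (n + 1) := by field_simp; ring
      rw [h3, inv_div, div_eq_mul_inv]
    have e3 : ∫⁻ t, ENNReal.ofReal ((t + 1 / ((n:ℝ) + 1))⁻¹) ∂σ =
        ENNReal.ofReal (∫ t, ((n:ℝ) + 1) * (1 + t * (n + 1))⁻¹ ∂σ) := by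
      rw [ofReal_integral_eq_lintegral_ofReal (hi'.const_mul _)]
      · apply lintegral_congr_ae
        filter_upwards [e2] with t ht
        rw [ht]
      · filter_upwards [hae] with t ht
        have : 0 < 1 + t * ((n:ℝ) + 1) := by nlinarith [ht.1]
        simp only [Pi.zero_apply]
        positivity
    rw [e3, ← ENNReal.ofReal_one]
    apply ENNReal.ofReal_le_ofReal
    have e4 : (∫ t, -((n:ℝ) + 1) * (1 + t * (n + 1))⁻¹ ∂σ) =
      - ∫ t, ((n:ℝ) + 1) * (1 + t * (n + 1))⁻¹ ∂σ := by
      rw [← integral_neg]; congr 1 with t; ring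
    rw [e4] at h1
    linarith
  have hlim : ∀ᵐ t ∂σ, (ENNReal.ofReal t)⁻¹ =
      liminf (fun n : ℕ => ENNReal.ofReal ((t + 1 / ((n:ℝ) + 1))⁻¹)) atTop := by
    filter_upwards [hae] with t ht
    symm
    apply Tendsto.liminf_eq
    have e : ∀ n : ℕ, ENNReal.ofReal ((t + 1 / ((n:ℝ) + 1))⁻¹) =
        (ENNReal.ofReal (t + 1 / ((n:ℝ) + 1)))⁻¹ := by
      intro n
      apply ENNReal.ofReal_inv_of_pos
      have : (0:ℝ) < 1 / ((n:ℝ) + 1) := by positivity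
      linarith [ht.1]
    simp only [e]
    apply Tendsto.inv
    apply ENNReal.tendsto_ofReal
    simpa using (tendsto_const_nhds (x := t)).add (tendsto_one_div_add_atTop_nhds_zero_nat (𝕜 := ℝ))
  rw [lintegral_congr_ae hlim]
  refine (lintegral_liminf_le (fun n => by fun_prop)).trans ?_
  exact liminf_le_of_le (by isBoundedDefault) (fun b hb => by
    obtain ⟨n, hn⟩ := hb.exists
    exact hn.trans (key n))

lemma add_atom {σ : Measure ℝ} [IsFiniteMeasure σ] (hσ : σ (Set.Icc (0:ℝ) 1)ᶜ = 0)
    (hpos : ∀ x : ℝ, x < 0 → 0 ≤ (1 + (x:ℂ) * ∫ t, (1 - (t:ℂ) * (x:ℂ))⁻¹ ∂σ).re) :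
    ∃ μ : Measure ℝ, IsProbabilityMeasure μ ∧ μ (Set.Icc (0:ℝ) 1)ᶜ = 0 ∧
      ∀ z ∈ SlitOne, 1 + z * ∫ t, (1 - (t:ℂ) * z)⁻¹ ∂σ = ∫ t, (1 - (t:ℂ) * z)⁻¹ ∂μ := by
  have hle := lint_le hσ hpos
  have hae : ∀ᵐ t ∂σ, t ∈ Set.Icc (0:ℝ) 1 := hσ
  set d : ℝ → ENNReal := fun t => (ENNReal.ofReal t)⁻¹ with hd
  have hdm : Measurable d := by fun_prop
  set m : ENNReal := ∫⁻ t, d t ∂σ with hm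
  have hmt : m ≠ ⊤ := (hle.trans_lt ENNReal.one_lt_top).ne
  have hdt : ∀ᵐ t ∂σ, d t < ⊤ := ae_lt_top hdm hmt
  set μ₀ := σ.withDensity d with hμ₀
  have hμu : μ₀ Set.univ = m := by simp [hμ₀, hm]
  have hf0 : IsFiniteMeasure μ₀ := ⟨by rw [hμu]; exact hmt.lt_top⟩
  have hμ0c : μ₀ (Set.Icc (0:ℝ) 1)ᶜ = 0 := withDensity_absolutelyContinuous σ d hσ
  set μ : Measure ℝ := μ₀ + (1 - m) • Measure.dirac 0 with hμ
  have hpm : IsProbabilityMeasure μ := ⟨by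
    simp [hμ, hμu, add_tsub_cancel_of_le hle]⟩
  refine ⟨μ, hpm, ?_, ?_⟩
  · simp [hμ, hμ0c]
  · intro z hz
    have hi0 := kernel_int hμ0c hz
    have hnt : (1 - m) ≠ ⊤ := (tsub_le_self.trans_lt ENNReal.one_lt_top).ne
    have hi1 : Integrable (fun t : ℝ => (1 - (t:ℂ) * z)⁻¹) ((1 - m) • Measure.dirac (0:ℝ)) :=
      (integrable_dirac (by simp)).smul_measure hnt
    have hid : Integrable (fun t => (d t).toReal) σ :=
      integrable_toReal_of_lintegral_ne_top hdm.aemeasurable hmt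
    have hmr : ∫ t, (d t).toReal ∂σ = m.toReal := integral_toReal hdm.aemeasurable hdt
    have hi2 : Integrable (fun t : ℝ => (d t).toReal • (1 - (t:ℂ) * z)⁻¹) σ :=
      (integrable_withDensity_iff_integrable_smul' hdm hdt).1 hi0
    rw [hμ, integral_add_measure hi0 hi1, integral_smul_measure, integral_dirac,
      integral_withDensity_eq_integral_toReal_smul hdm hdt, ENNReal.toReal_sub_of_le hle (by simp),
      ← hmr, ← integral_const_mul]
    have hpt : ∀ᵐ t : ℝ ∂σ, z * (1 - (t:ℂ) * z)⁻¹ =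
        (d t).toReal • (1 - (t:ℂ) * z)⁻¹ - (((d t).toReal : ℝ) : ℂ) := by
      filter_upwards [hae, hdt] with t ht htop
      have htp : 0 < t := by
        rcases ht.1.lt_or_eq with h | h
        · exact h
        · exfalso
          simp [hd, ← h] at htop
      have hne := kernel_ne hz ht
      have hdt' : (d t).toReal = t⁻¹ := by
        simp [hd, ENNReal.toReal_inv, ENNReal.toReal_ofReal ht.1]
      have htc : (t:ℂ) ≠ 0 := by exact_mod_cast htp.ne'
      rw [hdt', Complex.real_smul]
      push_cast
      have hne' : 1 - z * (t:ℂ) ≠ 0 := by rwa [mul_comm z]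
      field_simp
      ring
    have hidc : Integrable (fun t : ℝ => (((d t).toReal : ℝ) : ℂ)) σ := hid.ofReal
    rw [integral_congr_ae hpt, integral_sub hi2 hidc, integral_complex_ofReal]
    simp
    ring

lemma one_sub_koe {w : ℂ} (hw : ‖w‖ < 1) : 1 - koe w = ((1 - w) / (1 + w))^2 := by
  have h := disc_ne3 hw
  rw [koe]
  field_simp
  ring

lemma cayley_re_pos {w : ℂ} (hw : ‖w‖ < 1) : 0 < ((1 - w) / (1 + w)).re := by
  have h := disc_ne3 hw
  rw [div_re, ← add_div]
  apply div_pos _ (normSq_pos.2 h)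
  have h2 : w.re * w.re + w.im * w.im < 1 := by
    rw [← normSq_apply, normSq_eq_norm_sq]
    nlinarith [norm_nonneg w]
  simp
  nlinarith

lemma sq_slit {q : ℂ} (hq : 0 < q.re) : q^2 ∈ slitPlane := by
  rw [mem_slitPlane_iff]
  by_cases h : q.im = 0
  · left; simp [sq, h]; positivity
  · right
    simp [sq]
    intro h2
    have : q.re * q.im = 0 := by linarith
    rcases mul_eq_zero.1 this with h3 | h3
    · exact hq.ne' h3
    · exact h h3

lemma koe_mem {w : ℂ} (hw : ‖w‖ < 1) : koe w ∈ SlitOne := by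
  change 1 - koe w ∈ slitPlane
  rw [one_sub_koe hw]
  exact sq_slit (cayley_re_pos hw)

lemma koe_cayley {q z : ℂ} (hq : 0 < q.re) (h : q^2 = 1 - z) :
    ‖(1 - q) / (1 + q)‖ < 1 ∧ koe ((1 - q) / (1 + q)) = z := by
  have hne : 1 + q ≠ 0 := by
    intro h0
    have := congrArg Complex.re h0
    simp at this
    linarith
  constructor
  · rw [norm_div, div_lt_one (norm_pos_iff.2 hne)]
    apply lt_of_pow_lt_pow_left₀ 2 (norm_nonneg _)
    rw [← normSq_eq_norm_sq, ← normSq_eq_norm_sq, normSq_apply, normSq_apply]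
    simp
    nlinarith
  · have hz : z = 1 - q^2 := by rw [h]; ring
    have h3 : 1 + (1 - q) / (1 + q) = 2 / (1 + q) := by field_simp; ring
    rw [koe, h3, hz]
    field_simp
    ring

lemma koe_surj {z : ℂ} (hz : z ∈ SlitOne) : ∃ w : ℂ, ‖w‖ < 1 ∧ koe w = z := by
  obtain ⟨q, hq'⟩ := (IsAlgClosed.exists_pow_nat_eq (1 - z) (n := 2) (by norm_num))
  have hq : 1 - z = q^2 := hq'.symm
  have hre : q.re ≠ 0 := by
    intro h0
    have hz' : 1 - z ∈ slitPlane := hz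
    rw [hq, mem_slitPlane_iff] at hz'
    simp [sq, h0] at hz'
    nlinarith [mul_self_nonneg q.im]
  rcases lt_or_gt_of_ne hre with h | h
  · exact ⟨_, koe_cayley (q := -q) (by simpa using h) (by rw [hq]; ring)⟩
  · exact ⟨_, koe_cayley h hq.symm⟩

lemma koe_surj_real {x : ℝ} (hx : x < 0) : ∃ w : ℝ, ‖(w:ℂ)‖ < 1 ∧ koe (w:ℂ) = (x:ℂ) := by
  have hp : 0 < Real.sqrt (1 - x) := Real.sqrt_pos.2 (by linarith)
  have := koe_cayley (q := (Real.sqrt (1 - x) : ℂ)) (z := (x:ℂ)) (by simpa using hp) (by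
    rw [← ofReal_pow, Real.sq_sqrt (by linarith)]; push_cast; ring)
  refine ⟨(1 - Real.sqrt (1 - x)) / (1 + Real.sqrt (1 - x)), ?_⟩
  push_cast
  exact this

lemma koe_ofReal (w : ℝ) : koe (w:ℂ) = ((4 * w / (1 + w)^2 : ℝ) : ℂ) := by
  rw [koe]; push_cast; rfl

lemma koe_conj (w : ℂ) : koe (starRingEnd ℂ w) = starRingEnd ℂ (koe w) := by
  have h4 : starRingEnd ℂ (4:ℂ) = 4 := by
    rw [show (4:ℂ) = ((4:ℝ):ℂ) by norm_num, conj_ofReal]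
  simp [koe, h4]

lemma koe_im {w : ℂ} (hw : ‖w‖ < 1) (him : 0 ≤ w.im) : 0 ≤ (koe w).im := by
  have h := disc_ne3 hw
  have h2 : w.re * w.re + w.im * w.im < 1 := by
    rw [← normSq_apply, normSq_eq_norm_sq]
    nlinarith [norm_nonneg w]
  rw [koe, div_im, ← sub_div]
  apply div_nonneg _ (normSq_nonneg _)
  simp [sq]
  have := mul_nonneg him (sub_nonneg.2 h2.le)
  nlinarith

structure GoodFn (h : ℂ → ℂ) : Prop where
  diff : ∀ z ∈ SlitOne, DifferentiableAt ℂ h z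
  conj : ∀ z, h (starRingEnd ℂ z) = starRingEnd ℂ (h z)
  im : ∀ z ∈ SlitOne, 0 ≤ z.im → 0 ≤ (h z).im
  pos : ∀ x : ℝ, (x:ℂ) ∈ SlitOne → 0 ≤ (h x).re
  zero : h 0 = 1

lemma rescaled {h : ℂ → ℂ} (hh : GoodFn h) {r : ℝ} (hr0 : 0 ≤ r) (hr1 : r < 1) :
    ∃ μ : Measure ℝ, IsProbabilityMeasure μ ∧ μ (Set.Icc (0:ℝ) 1)ᶜ = 0 ∧
      ∀ w : ℂ, ‖w‖ < 1 → h (koe (r * w)) = ∫ t, (1 - (t:ℂ) * koe w)⁻¹ ∂μ := by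
  have hnorm : ∀ w : ℂ, ‖w‖ ≤ 1 → ‖(r:ℂ) * w‖ < 1 := by
    intro w hw
    rw [norm_mul, Complex.norm_real, Real.norm_eq_abs, abs_of_nonneg hr0]
    nlinarith [norm_nonneg w]
  set G : ℂ → ℂ := fun w => h (koe (r * w)) with hG
  have hGd : ∀ w : ℂ, ‖w‖ ≤ 1 → DifferentiableAt ℂ G w := by
    intro w hw
    have h1 := hh.diff _ (koe_mem (hnorm w hw))
    have hne := disc_ne3 (hnorm w hw)
    have h2 : DifferentiableAt ℂ (fun w : ℂ => koe (r * w)) w := by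
      unfold koe
      apply DifferentiableAt.div (by fun_prop) (by fun_prop)
      exact pow_ne_zero _ hne
    exact DifferentiableAt.comp w h1 h2
  have hGc : ∀ w : ℂ, G (starRingEnd ℂ w) = starRingEnd ℂ (G w) := by
    intro w
    have : (r:ℂ) * starRingEnd ℂ w = starRingEnd ℂ (r * w) := by simp
    simp only [hG]
    rw [this, koe_conj, hh.conj]
  have hGim : ∀ w : ℂ, ‖w‖ ≤ 1 → 0 ≤ w.im → 0 ≤ (G w).im := by
    intro w hw him
    apply hh.im _ (koe_mem (hnorm w hw))
    apply koe_im (hnorm w hw)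
    rw [im_ofReal_mul]
    positivity
  have hG0 : G 0 = 1 := by simp [hG, koe, hh.zero]
  obtain ⟨σ, hf, hσ, hrep⟩ := disc_measure (G := G)
    (fun w hw => (hGd w (by simpa using hw)).continuousAt.continuousWithinAt)
    (fun w hw => (hGd w (by simpa using (mem_ball_zero_iff.1 hw).le)).differentiableWithinAt)
    (fun w _ => hGc w)
    (by
      intro ζ hζ
      have h0 : ‖ζ‖ ≤ 1 := by simpa using Metric.sphere_subset_closedBall hζ
      rcases le_total 0 ζ.im with h1 | h1
      · exact mul_nonneg h1 (hGim ζ h0 h1)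
      · have := hGim (starRingEnd ℂ ζ) (by simpa using h0) (by simpa using h1)
        rw [hGc] at this
        simp at this
        exact mul_nonneg_of_nonpos_of_nonpos h1 this)
  have hrep' : ∀ w : ℂ, ‖w‖ < 1 → G w = 1 + koe w * ∫ t, (1 - (t:ℂ) * koe w)⁻¹ ∂σ := by
    intro w hw
    rw [← hrep w hw, hG0]; ring
  obtain ⟨μ, hp, hμ, hμrep⟩ := add_atom hσ (by
    intro x hx
    obtain ⟨w, hw, hwx⟩ := koe_surj_real hx
    rw [← hwx, ← hrep' w hw]
    simp only [hG]
    have hm := koe_mem (hnorm w hw.le)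
    rw [← ofReal_mul, koe_ofReal] at hm ⊢
    exact hh.pos _ hm)
  refine ⟨μ, hp, hμ, fun w hw => ?_⟩
  rw [← hμrep _ (koe_mem hw)]
  exact hrep' w hw

lemma representation {h : ℂ → ℂ} (hh : GoodFn h) :
    ∃ μ : Measure ℝ, IsProbabilityMeasure μ ∧ μ (Set.Icc (0:ℝ) 1)ᶜ = 0 ∧
      ∀ z ∈ SlitOne, h z = ∫ t, (1 - (t:ℂ) * z)⁻¹ ∂μ := by
  set r : ℕ → ℝ := fun n => 1 - 1 / ((n:ℝ) + 1) with hr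
  have hr0 : ∀ n, 0 ≤ r n := by
    intro n
    have : 1 / ((n:ℝ) + 1) ≤ 1 := by
      rw [div_le_one (by positivity)]
      have : (0:ℝ) ≤ n := by positivity
      linarith
    simp only [hr]; linarith
  have hr1 : ∀ n, r n < 1 := by
    intro n
    have : (0:ℝ) < 1 / ((n:ℝ) + 1) := by positivity
    simp only [hr]; linarith
  have hrl : Tendsto r atTop (𝓝 1) := by
    simpa [hr] using (tendsto_const_nhds (x := (1:ℝ))).sub
      (tendsto_one_div_add_atTop_nhds_zero_nat (𝕜 := ℝ))
  choose μ hp hμ hrep using fun n => rescaled hh (hr0 n) (hr1 n)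
  set P : ℕ → ProbabilityMeasure ℝ := fun n => ⟨μ n, hp n⟩ with hP
  have hcomp := isCompact_setOfPred_probabilityMeasure_mass_eq_compl_isCompact_le
    (E := ℝ) (u := fun _ => 0) (K := fun _ => Set.Icc (0:ℝ) 1) tendsto_const_nhds
    (fun _ => isCompact_Icc) (Or.inl inferInstance)
  have hmem : ∀ n, P n ∈ {μ : ProbabilityMeasure ℝ | ∀ _ : ℕ, μ (Set.Icc (0:ℝ) 1)ᶜ ≤ 0} := by
    intro n _
    apply le_of_eq
    rw [← ENNReal.coe_eq_zero, ProbabilityMeasure.ennreal_coeFn_eq_coeFn_toMeasure]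
    exact hμ n
  set U : Ultrafilter ℕ := hyperfilter ℕ with hU
  have hUle : (U : Filter ℕ) ≤ atTop := by
    rw [← Nat.cofinite_eq_atTop]; exact hyperfilter_le_cofinite
  obtain ⟨Q, hQ, hQl⟩ := hcomp.ultrafilter_le_nhds (U.map P) (by
    rw [le_principal_iff]
    exact Ultrafilter.mem_map.2 (Filter.univ_mem' hmem))
  have hQt : Tendsto P U (𝓝 Q) := hQl
  have hQ0 : (Q : Measure ℝ) (Set.Icc (0:ℝ) 1)ᶜ = 0 := by
    have := hQ 0
    rw [← ProbabilityMeasure.ennreal_coeFn_eq_coeFn_toMeasure, ENNReal.coe_eq_zero]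
    exact le_antisymm this bot_le
  refine ⟨Q, inferInstance, hQ0, ?_⟩
  intro z hz
  obtain ⟨w, hw, rfl⟩ := koe_surj hz
  set z := koe w with hzw
  obtain ⟨C, hC⟩ := kernel_bound1 hz
  have hcl : ∀ t : ℝ, max 0 (min 1 t) ∈ Set.Icc (0:ℝ) 1 := fun t =>
    ⟨le_max_left _ _, max_le zero_le_one (min_le_left _ _)⟩
  set k : BoundedContinuousFunction ℝ ℂ := BoundedContinuousFunction.ofNormedAddCommGroup
    (fun t : ℝ => (1 - ((max 0 (min 1 t) : ℝ) : ℂ) * z)⁻¹) (by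
      apply Continuous.inv₀ (by fun_prop)
      intro t
      exact kernel_ne hz (hcl t)) C (fun t => hC _ (hcl t)) with hk
  have hkeq : ∀ ν : Measure ℝ, ν (Set.Icc (0:ℝ) 1)ᶜ = 0 →
      ∫ t, k t ∂ν = ∫ t, (1 - (t:ℂ) * z)⁻¹ ∂ν := by
    intro ν hν
    apply integral_congr_ae
    have : ∀ᵐ t ∂ν, t ∈ Set.Icc (0:ℝ) 1 := hν
    filter_upwards [this] with t ht
    simp only [hk, BoundedContinuousFunction.coe_ofNormedAddCommGroup]
    rw [min_eq_right ht.2, max_eq_right ht.1]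
  have hlim1 := (ProbabilityMeasure.tendsto_iff_forall_integral_rclike_tendsto ℂ).1 hQt k
  rw [hkeq _ hQ0] at hlim1
  have hlim2 : Tendsto (fun n => h (koe (r n * w))) atTop (𝓝 (h z)) := by
    have h1 : ContinuousAt h (koe w) := (hh.diff _ hz).continuousAt
    have h2 : ContinuousAt koe w := by
      unfold koe
      apply ContinuousAt.div₀ (by fun_prop) (by fun_prop)
      exact pow_ne_zero _ (disc_ne3 hw)
    have h3 : Tendsto (fun n => (r n : ℂ) * w) atTop (𝓝 w) := by
      have : Tendsto (fun n => (r n : ℂ)) atTop (𝓝 ((1:ℝ):ℂ)) :=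
        (continuous_ofReal.tendsto _).comp hrl
      simpa using this.mul_const w
    exact h1.tendsto.comp (h2.tendsto.comp h3)
  refine tendsto_nhds_unique (hlim2.mono_left hUle) ?_
  refine hlim1.congr fun n => ?_
  rw [hrep n w hw]
  exact hkeq _ (hμ n)

theorem stmt10 (φ ψ : ℝ → ℝ)
    (hφm : Measurable φ) (hψm : Measurable ψ)
    (hφ0 : ∀ t ∈ Set.Ioo (0:ℝ) 1, 0 ≤ φ t) (hψ0 : ∀ t ∈ Set.Ioo (0:ℝ) 1, 0 ≤ ψ t)
    (hφint : ∫ t in Set.Ioo (0:ℝ) 1, φ t = 1) (hψint : ∫ t in Set.Ioo (0:ℝ) 1, ψ t = 1)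
    (hcond : ∀ s t : ℝ, 0 < s → s < t → t < 1 → φ s * ψ t ≤ φ t * ψ s)
    (f g : ℂ → ℂ)
    (hf : ∀ z : ℂ, f z = ∫ t in Set.Ioo (0:ℝ) 1, (φ t : ℂ) * (1 - (t:ℂ) * z)⁻¹)
    (hg : ∀ z : ℂ, g z = ∫ t in Set.Ioo (0:ℝ) 1, (ψ t : ℂ) * (1 - (t:ℂ) * z)⁻¹) :
    ∃ μ : Measure ℝ, IsProbabilityMeasure μ ∧ μ (Set.Icc (0:ℝ) 1)ᶜ = 0 ∧
      ∀ z : ℂ, ¬(z.im = 0 ∧ 1 ≤ z.re) →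
        f z / g z = ∫ t, (1 - (t:ℂ) * z)⁻¹ ∂μ := by
  have hφi : IntegrableOn φ (Set.Ioo (0:ℝ) 1) := by
    by_contra hc
    rw [integral_undef hc] at hφint
    exact zero_ne_one hφint
  have hψi : IntegrableOn ψ (Set.Ioo (0:ℝ) 1) := by
    by_contra hc
    rw [integral_undef hc] at hψint
    exact zero_ne_one hψint
  have hgood : GoodFn (fun z => f z / g z) := by
    obtain rfl : f = _ := funext hf
    obtain rfl : g = _ := funext hg
    constructor
    · intro z hz
      exact (stieltjes_diff hφi hz).div (stieltjes_diff hψi hz) (stieltjes_ne hψi hψ0 hψint hz)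
    · intro z
      simp only [stieltjes_conj, map_div₀]
    · intro z hz him
      exact quot_im_nonneg hφi hψi hcond hz him
    · intro x hx
      have hx1 : (x:ℂ).re < 1 := by
        by_contra hc
        exact (mem_SlitOne _).1 hx ⟨ofReal_im x, not_lt.1 hc⟩
      have h1 := stieltjes_real_re_pos hφi hφ0 hφint hx hx1
      have h2 := stieltjes_real_re_pos hψi hψ0 hψint hx hx1
      have h3 := stieltjes_im hφi hx
      simp only [ofReal_im, zero_mul] at h3
      simp only
      rw [div_re, h3, zero_mul, zero_div, add_zero]
      exact div_nonneg (mul_nonneg h1.le h2.le) (normSq_nonneg _)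
    · simp only
      rw [stieltjes_zero hφint, stieltjes_zero hψint, div_one]
  obtain ⟨μ, hp, hμ, hrep⟩ := representation hgood
  exact ⟨μ, hp, hμ, fun z hz => hrep z ((mem_SlitOne z).2 hz)⟩
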